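/- arXiv:2511.18048 — 6 statements merged into one kernel-verified Lean document; each statement's English description precedes it below -/
import Mathlib

section
/- For every n ≥ 1 and every q ∈ ℤ≥0, the function b ↦ J̃ₙ(q,b;0) is concave on [0,1]. -/
open Finset Filter Topology

noncomputable section

/-- Belief update map `𝒯(b) = b·p₁₁ + (1−b)·p₀₁`. -/
def beliefT (p01 p11 b : ℝ) : ℝ := b * p11 + (1 - b) * p01

/-- Queue update `𝒬⁺(q,a,d) = max(0, q−d) + a` (via truncated `ℕ` subtraction). -/
def Qplus (q a d : ℕ) : ℕ := (q - d) + a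

/-- One-step Bellman cost `J̃(q,b;u)` of action `u` given continuation value `Jprev`. -/
def Jtilde (Ma : ℕ) (p : ℕ → ℝ) (p01 p11 β κ : ℝ) (c : ℕ → ℝ)
    (Jprev : ℕ → ℝ → ℝ) (q : ℕ) (b : ℝ) (u : ℕ) : ℝ :=
  if u = 0 then
    (q : ℝ) + β * ∑ i ∈ Finset.range (Ma + 1),
      p i * Jprev (Qplus q i 0) (beliefT p01 p11 b)
  else
    (q : ℝ) + κ * c u + β * ∑ i ∈ Finset.range (Ma + 1),
      p i * (b * Jprev (Qplus q i u) p11 + (1 - b) * Jprev (Qplus q i 0) p01)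

/-- Value-iteration iterates `Jₙ(q,b)`, with `J₀ ≡ 0` and
`Jₙ(q,b) = min_{u ∈ {0,…,M_d}} J̃ₙ(q,b;u)`. -/
def Jiter (Ma Md : ℕ) (p : ℕ → ℝ) (p01 p11 β κ : ℝ) (c : ℕ → ℝ) :
    ℕ → ℕ → ℝ → ℝ
  | 0 => fun _ _ => 0
  | n + 1 => fun q b =>
      (Finset.range (Md + 1)).inf' ⟨0, Finset.mem_range.mpr (Nat.succ_pos _)⟩
        (fun u => Jtilde Ma p p01 p11 β κ c (Jiter Ma Md p p01 p11 β κ c n) q b u)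

theorem Jtilde_zero_concave
    (Ma : ℕ) (p : ℕ → ℝ) (hp : ∀ i ≤ Ma, p i ∈ Set.Icc (0:ℝ) 1)
    (p01 p11 : ℝ) (hp01 : p01 ∈ Set.Ioo (0:ℝ) 1) (hp11 : p11 ∈ Set.Ioo (0:ℝ) 1)
    (β : ℝ) (hβ : β ∈ Set.Ioo (0:ℝ) 1) (κ : ℝ) (c : ℕ → ℝ) (J : ℕ → ℝ → ℝ)
    (hJ : ∀ q, ConcaveOn ℝ (Set.Icc (0:ℝ) 1) (J q)) (q : ℕ) :
    ConcaveOn ℝ (Set.Icc (0:ℝ) 1) (fun b => Jtilde Ma p p01 p11 β κ c J q b 0) := by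
  obtain ⟨h1, h2⟩ := hp01
  obtain ⟨h3, h4⟩ := hp11
  have hT : ∀ b ∈ Set.Icc (0:ℝ) 1, beliefT p01 p11 b ∈ Set.Icc (0:ℝ) 1 := by
    rintro b ⟨hb0, hb1⟩
    unfold beliefT
    constructor <;> nlinarith
  refine ⟨convex_Icc 0 1, ?_⟩
  intro x hx y hy s t hs ht hst
  have key : ∑ i ∈ Finset.range (Ma + 1), p i * (s * J (Qplus q i 0) (beliefT p01 p11 x)
        + t * J (Qplus q i 0) (beliefT p01 p11 y))
      ≤ ∑ i ∈ Finset.range (Ma + 1), p i * J (Qplus q i 0) (beliefT p01 p11 (s * x + t * y)) := by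
    refine Finset.sum_le_sum fun i hi => ?_
    have hpi := (hp i (by have := Finset.mem_range.mp hi; omega)).1
    refine mul_le_mul_of_nonneg_left ?_ hpi
    have h := (hJ (Qplus q i 0)).2 (hT x hx) (hT y hy) hs ht hst
    have e : s * beliefT p01 p11 x + t * beliefT p01 p11 y = beliefT p01 p11 (s * x + t * y) := by
      unfold beliefT
      linear_combination p01 * hst
    simpa only [smul_eq_mul, e] using h
  have key2 := mul_le_mul_of_nonneg_left key hβ.1.le
  simp only [Jtilde, if_true, smul_eq_mul]
  simp only [mul_add, Finset.sum_add_distrib, mul_left_comm _ s, mul_left_comm _ t,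
    ← Finset.mul_sum] at key2 ⊢
  have : s * (q:ℝ) + t * q = q := by rw [← add_mul, hst, one_mul]
  linarith

theorem Jiter_concave
    (Ma Md : ℕ) (p : ℕ → ℝ) (hp : ∀ i ≤ Ma, p i ∈ Set.Icc (0:ℝ) 1)
    (p01 p11 : ℝ) (hp01 : p01 ∈ Set.Ioo (0:ℝ) 1) (hp11 : p11 ∈ Set.Ioo (0:ℝ) 1)
    (β : ℝ) (hβ : β ∈ Set.Ioo (0:ℝ) 1) (κ : ℝ) (c : ℕ → ℝ) (n : ℕ) :
    ∀ q, ConcaveOn ℝ (Set.Icc (0:ℝ) 1) (Jiter Ma Md p p01 p11 β κ c n q) := by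
  induction n with
  | zero => intro q; exact concaveOn_const 0 (convex_Icc 0 1)
  | succ n ih =>
    intro q
    have hall : ∀ u, ConcaveOn ℝ (Set.Icc (0:ℝ) 1)
        (fun b => Jtilde Ma p p01 p11 β κ c (Jiter Ma Md p p01 p11 β κ c n) q b u) := by
      intro u
      rcases Nat.eq_zero_or_pos u with rfl | hu
      · exact Jtilde_zero_concave Ma p hp p01 p11 hp01 hp11 β hβ κ c _ ih q
      · refine ⟨convex_Icc 0 1, ?_⟩
        intro x _ y _ s t _ _ hst
        simp only [Jtilde, if_neg hu.ne', smul_eq_mul]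
        apply le_of_eq
        have e : ∀ (b : ℝ) (A B : ℕ → ℝ), ∑ i ∈ Finset.range (Ma + 1),
            p i * (b * A i + (1 - b) * B i) = b * ∑ i ∈ Finset.range (Ma + 1), p i * A i
              + (1 - b) * ∑ i ∈ Finset.range (Ma + 1), p i * B i := by
          intro b A B
          simp only [mul_add, Finset.sum_add_distrib, Finset.mul_sum, mul_left_comm]
        rw [e, e, e]
        obtain rfl : t = 1 - s := by linarith
        ring
    refine ⟨convex_Icc 0 1, ?_⟩
    intro x hx y hy s t hs ht hst
    simp only [Jiter]
    refine Finset.le_inf' _ _ fun u hu => ?_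
    refine le_trans ?_ ((hall u).2 hx hy hs ht hst)
    simp only [smul_eq_mul]
    exact add_le_add (mul_le_mul_of_nonneg_left (Finset.inf'_le _ hu) hs)
      (mul_le_mul_of_nonneg_left (Finset.inf'_le _ hu) ht)

theorem stmt6
    (Ma Md : ℕ) (hMa : 1 ≤ Ma) (hMd : 1 ≤ Md)
    (p : ℕ → ℝ) (hp : ∀ i ≤ Ma, p i ∈ Set.Icc (0:ℝ) 1)
    (hpsum : ∑ i ∈ Finset.range (Ma + 1), p i = 1)
    (p01 p11 : ℝ) (hp01 : p01 ∈ Set.Ioo (0:ℝ) 1) (hp11 : p11 ∈ Set.Ioo (0:ℝ) 1)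
    (β : ℝ) (hβ : β ∈ Set.Ioo (0:ℝ) 1)
    (κ : ℝ) (hκ : 0 < κ)
    (c : ℕ → ℝ) (hc0 : c 0 = 0) (hcnn : ∀ u ≤ Md, 0 ≤ c u)
    (hcmono : ∀ u v : ℕ, u < v → v ≤ Md → c u < c v) :
    ∀ (n q : ℕ),
      ConcaveOn ℝ (Set.Icc (0:ℝ) 1)
        (fun b => Jtilde Ma p p01 p11 β κ c (Jiter Ma Md p p01 p11 β κ c n) q b 0) := by
  intro n q
  exact Jtilde_zero_concave Ma p hp p01 p11 hp01 hp11 β hβ κ c _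
    (Jiter_concave Ma Md p hp p01 p11 hp01 hp11 β hβ κ c n) q
end
end

section
/- For every n ∈ ℤ≥0 and every q ∈ ℤ≥0, the function b ↦ Jₙ(q,b) is concave on [0,1]; consequently, the limit value function b ↦ J(q,b) is concave on [0,1] for every q. -/
open Finset Filter Topology

noncomputable section

theorem stmt7
    (Ma Md : ℕ) (hMa : 1 ≤ Ma) (hMd : 1 ≤ Md)
    (p : ℕ → ℝ) (hp : ∀ i ≤ Ma, p i ∈ Set.Icc (0:ℝ) 1)
    (hpsum : ∑ i ∈ Finset.range (Ma + 1), p i = 1)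
    (p01 p11 : ℝ) (hp01 : p01 ∈ Set.Ioo (0:ℝ) 1) (hp11 : p11 ∈ Set.Ioo (0:ℝ) 1)
    (β : ℝ) (hβ : β ∈ Set.Ioo (0:ℝ) 1)
    (κ : ℝ) (hκ : 0 < κ)
    (c : ℕ → ℝ) (hc0 : c 0 = 0) (hcnn : ∀ u ≤ Md, 0 ≤ c u)
    (hcmono : ∀ u v : ℕ, u < v → v ≤ Md → c u < c v)
    (Jlim : ℕ → ℝ → ℝ)
    (hJlim : ∀ (q : ℕ), ∀ b ∈ Set.Icc (0:ℝ) 1,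
      Tendsto (fun n => Jiter Ma Md p p01 p11 β κ c n q b) atTop (𝓝 (Jlim q b))) :
    (∀ (n q : ℕ), ConcaveOn ℝ (Set.Icc (0:ℝ) 1) (fun b => Jiter Ma Md p p01 p11 β κ c n q b)) ∧
    (∀ q : ℕ, ConcaveOn ℝ (Set.Icc (0:ℝ) 1) (fun b => Jlim q b)) := by
  have key : ∀ (n q : ℕ), ConcaveOn ℝ (Set.Icc (0:ℝ) 1)
      (fun b => Jiter Ma Md p p01 p11 β κ c n q b) := by
    intro n
    induction n with
    | zero =>
      intro q
      simp only [Jiter]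
      exact concaveOn_const _ (convex_Icc _ _)
    | succ n ih =>
      intro q
      refine ⟨convex_Icc _ _, ?_⟩
      intro x hx y hy s t hs ht hst
      simp only [Jiter, smul_eq_mul]
      refine Finset.le_inf' _ _ ?_
      intro u hu
      have h1 := Finset.inf'_le (fun u => Jtilde Ma p p01 p11 β κ c
        (Jiter Ma Md p p01 p11 β κ c n) q x u) hu
      have h2 := Finset.inf'_le (fun u => Jtilde Ma p p01 p11 β κ c
        (Jiter Ma Md p p01 p11 β κ c n) q y u) hu
      refine le_trans (add_le_add (mul_le_mul_of_nonneg_left h1 hs)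
        (mul_le_mul_of_nonneg_left h2 ht)) ?_
      have hs' : s = 1 - t := by linarith
      have hT : ∀ z ∈ Set.Icc (0:ℝ) 1, beliefT p01 p11 z ∈ Set.Icc (0:ℝ) 1 := by
        intro z hz
        obtain ⟨a1, a2⟩ := hz
        obtain ⟨b1, b2⟩ := hp01
        obtain ⟨c1, c2⟩ := hp11
        unfold beliefT
        constructor <;> nlinarith
      have comb : ∀ (A : ℝ) (f g h : ℕ → ℝ),
          (∀ i, s * f i + t * g i ≤ h i) →
          s * (A + β * ∑ i ∈ Finset.range (Ma + 1), p i * f i) +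
          t * (A + β * ∑ i ∈ Finset.range (Ma + 1), p i * g i) ≤
          A + β * ∑ i ∈ Finset.range (Ma + 1), p i * h i := by
        intro A f g h H
        have hS : s * ∑ i ∈ Finset.range (Ma + 1), p i * f i +
            t * ∑ i ∈ Finset.range (Ma + 1), p i * g i ≤
            ∑ i ∈ Finset.range (Ma + 1), p i * h i := by
          rw [Finset.mul_sum, Finset.mul_sum, ← Finset.sum_add_distrib]
          refine Finset.sum_le_sum fun i hi => ?_
          have hpi := (hp i (Nat.lt_succ_iff.mp (Finset.mem_range.mp hi))).1
          have := mul_le_mul_of_nonneg_left (H i) hpi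
          linarith
        have hS2 := mul_le_mul_of_nonneg_left hS hβ.1.le
        have hA : s * A + t * A = A := by rw [← add_mul, hst, one_mul]
        linarith
      unfold Jtilde
      by_cases hu0 : u = 0
      · simp only [hu0, if_true]
        apply comb
        intro i
        have h3 := (ih (Qplus q i 0)).2 (hT x hx) (hT y hy) hs ht hst
        have e : s • beliefT p01 p11 x + t • beliefT p01 p11 y
            = beliefT p01 p11 (s * x + t * y) := by
          simp only [smul_eq_mul, beliefT, hs']
          ring
        rw [e] at h3
        simpa only [smul_eq_mul] using h3
      · simp only [hu0, if_false]
        apply comb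
        intro i
        apply le_of_eq
        simp only [hs']
        ring
  refine ⟨key, fun q => ⟨convex_Icc _ _, ?_⟩⟩
  intro x hx y hy s t hs ht hst
  have hz := (convex_Icc (0:ℝ) 1) hx hy hs ht hst
  exact le_of_tendsto_of_tendsto'
    (((hJlim q x hx).const_smul s).add ((hJlim q y hy).const_smul t))
    (hJlim q _ hz) (fun n => (key n q).2 hx hy hs ht hst)
end
end

section
/- For every n ∈ ℤ≥0 and every b ∈ [0,1], the function q ↦ Jₙ(q,b) is monotone nondecreasing on ℤ≥0; consequently, the limit value function q ↦ J(q,b) is monotone nondecreasing for every b ∈ [0,1]. -/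
open Finset Filter Topology

noncomputable section

theorem stmt8
    (Ma Md : ℕ) (hMa : 1 ≤ Ma) (hMd : 1 ≤ Md)
    (p : ℕ → ℝ) (hp : ∀ i ≤ Ma, p i ∈ Set.Icc (0:ℝ) 1)
    (hpsum : ∑ i ∈ Finset.range (Ma + 1), p i = 1)
    (p01 p11 : ℝ) (hp01 : p01 ∈ Set.Ioo (0:ℝ) 1) (hp11 : p11 ∈ Set.Ioo (0:ℝ) 1)
    (β : ℝ) (hβ : β ∈ Set.Ioo (0:ℝ) 1)
    (κ : ℝ) (hκ : 0 < κ)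
    (c : ℕ → ℝ) (hc0 : c 0 = 0) (hcnn : ∀ u ≤ Md, 0 ≤ c u)
    (hcmono : ∀ u v : ℕ, u < v → v ≤ Md → c u < c v)
    (Jlim : ℕ → ℝ → ℝ)
    (hJlim : ∀ (q : ℕ), ∀ b ∈ Set.Icc (0:ℝ) 1,
      Tendsto (fun n => Jiter Ma Md p p01 p11 β κ c n q b) atTop (𝓝 (Jlim q b))) :
    (∀ (n : ℕ), ∀ b ∈ Set.Icc (0:ℝ) 1,
      Monotone (fun q : ℕ => Jiter Ma Md p p01 p11 β κ c n q b)) ∧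
    (∀ b ∈ Set.Icc (0:ℝ) 1, Monotone (fun q : ℕ => Jlim q b)) := by
  have key : ∀ (n : ℕ), ∀ b ∈ Set.Icc (0:ℝ) 1,
      Monotone (fun q : ℕ => Jiter Ma Md p p01 p11 β κ c n q b) := by
    intro n
    induction n with
    | zero =>
      intro b _ q r _
      simp [Jiter]
    | succ n ih =>
      intro b hb q r hqr
      have hb0 : 0 ≤ b := hb.1
      have hb1 : 0 ≤ 1 - b := sub_nonneg.mpr hb.2
      have hqr' : (q : ℝ) ≤ r := Nat.cast_le.mpr hqr
      have hQ : ∀ i d, Qplus q i d ≤ Qplus r i d := by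
        intro i d
        unfold Qplus
        omega
      have hT : beliefT p01 p11 b ∈ Set.Icc (0:ℝ) 1 := by
        have h1 := hp01.1
        have h2 := hp01.2
        have h3 := hp11.1
        have h4 := hp11.2
        unfold beliefT
        constructor
        · positivity
        · nlinarith [mul_nonneg hb0 (sub_nonneg.mpr h4.le), mul_nonneg hb1 (sub_nonneg.mpr h2.le)]
      have hp' : ∀ i ∈ Finset.range (Ma + 1), 0 ≤ p i := fun i hi =>
        (hp i (Nat.lt_succ_iff.mp (Finset.mem_range.mp hi))).1
      simp only [Jiter]
      refine Finset.le_inf' _ _ fun u hu => (Finset.inf'_le _ hu).trans ?_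
      unfold Jtilde
      split_ifs
      · refine add_le_add hqr' (mul_le_mul_of_nonneg_left (Finset.sum_le_sum fun i hi => ?_) hβ.1.le)
        exact mul_le_mul_of_nonneg_left (ih _ hT (hQ i 0)) (hp' i hi)
      · refine add_le_add (add_le_add hqr' le_rfl)
          (mul_le_mul_of_nonneg_left (Finset.sum_le_sum fun i hi => ?_) hβ.1.le)
        refine mul_le_mul_of_nonneg_left (add_le_add ?_ ?_) (hp' i hi)
        · exact mul_le_mul_of_nonneg_left (ih _ ⟨hp11.1.le, hp11.2.le⟩ (hQ i u)) hb0
        · exact mul_le_mul_of_nonneg_left (ih _ ⟨hp01.1.le, hp01.2.le⟩ (hQ i 0)) hb1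
  refine ⟨key, fun b hb q r hqr => ?_⟩
  exact le_of_tendsto_of_tendsto' (hJlim q b hb) (hJlim r b hb) fun n => key n b hb hqr
end
end

section
/- For every q ∈ ℤ≥0 and every pair of actions u₁, u₂ with 1 ≤ u₁ < u₂ ≤ M_d, the map b ↦ J̃(q,b;u₂) − J̃(q,b;u₁) is affine and monotone nonincreasing on [0,1], and its value at b = 0 equals κ·(c(u₂) − c(u₁)) > 0. Explicitly, J̃(q,b;u₂) − J̃(q,b;u₁) = κ·(c(u₂) − c(u₁)) + β·b·∑_{i=0}^{M_a} p_i·( J(𝒬⁺(q,i,u₂), p₁₁) − J(𝒬⁺(q,i,u₁), p₁₁) ), and the coefficient of b is nonpositive. -/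
open Finset Filter Topology

noncomputable section

theorem Jiter_mono_q
    (Ma Md : ℕ) (p : ℕ → ℝ) (hp : ∀ i ≤ Ma, p i ∈ Set.Icc (0:ℝ) 1)
    (p01 p11 : ℝ) (hp01 : p01 ∈ Set.Ioo (0:ℝ) 1) (hp11 : p11 ∈ Set.Ioo (0:ℝ) 1)
    (β : ℝ) (hβ : β ∈ Set.Ioo (0:ℝ) 1) (κ : ℝ) (c : ℕ → ℝ) (n : ℕ) :
    ∀ (q q' : ℕ), q ≤ q' → ∀ b ∈ Set.Icc (0:ℝ) 1,
      Jiter Ma Md p p01 p11 β κ c n q b ≤ Jiter Ma Md p p01 p11 β κ c n q' b := by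
  induction n with
  | zero => intro q q' _ b _; simp [Jiter]
  | succ n ih =>
    intro q q' hq b hb
    have hq' : (q : ℝ) ≤ q' := by exact_mod_cast hq
    have hQ : ∀ i u, Qplus q i u ≤ Qplus q' i u := by
      intro i u; unfold Qplus; omega
    have hT : beliefT p01 p11 b ∈ Set.Icc (0:ℝ) 1 := by
      obtain ⟨h1, h2⟩ := hp01
      obtain ⟨h3, h4⟩ := hp11
      obtain ⟨h5, h6⟩ := hb
      unfold beliefT
      constructor <;> nlinarith
    simp only [Jiter]
    apply Finset.le_inf'
    intro u hu
    refine (Finset.inf'_le _ hu).trans ?_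
    have hsum : ∀ f g : ℕ → ℝ, (∀ i, f i ≤ g i) →
        β * ∑ i ∈ Finset.range (Ma + 1), p i * f i ≤
          β * ∑ i ∈ Finset.range (Ma + 1), p i * g i := by
      intro f g hfg
      refine mul_le_mul_of_nonneg_left (Finset.sum_le_sum fun i hi => ?_) hβ.1.le
      exact mul_le_mul_of_nonneg_left (hfg i) (hp i (by simp at hi; omega)).1
    unfold Jtilde
    split_ifs
    · exact add_le_add hq' (hsum _ _ fun i => ih _ _ (hQ i 0) _ hT)
    · refine add_le_add (by linarith) (hsum _ _ fun i => ?_)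
      exact add_le_add
        (mul_le_mul_of_nonneg_left (ih _ _ (hQ i u) _ ⟨hp11.1.le, hp11.2.le⟩) hb.1)
        (mul_le_mul_of_nonneg_left (ih _ _ (hQ i 0) _ ⟨hp01.1.le, hp01.2.le⟩)
          (by linarith [hb.2]))

theorem stmt9
    (Ma Md : ℕ) (hMa : 1 ≤ Ma) (hMd : 1 ≤ Md)
    (p : ℕ → ℝ) (hp : ∀ i ≤ Ma, p i ∈ Set.Icc (0:ℝ) 1)
    (hpsum : ∑ i ∈ Finset.range (Ma + 1), p i = 1)
    (p01 p11 : ℝ) (hp01 : p01 ∈ Set.Ioo (0:ℝ) 1) (hp11 : p11 ∈ Set.Ioo (0:ℝ) 1)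
    (β : ℝ) (hβ : β ∈ Set.Ioo (0:ℝ) 1)
    (κ : ℝ) (hκ : 0 < κ)
    (c : ℕ → ℝ) (hc0 : c 0 = 0) (hcnn : ∀ u ≤ Md, 0 ≤ c u)
    (hcmono : ∀ u v : ℕ, u < v → v ≤ Md → c u < c v)
    (Jlim : ℕ → ℝ → ℝ)
    (hJlim : ∀ (q : ℕ), ∀ b ∈ Set.Icc (0:ℝ) 1,
      Tendsto (fun n => Jiter Ma Md p p01 p11 β κ c n q b) atTop (𝓝 (Jlim q b))) :
    ∀ (q u₁ u₂ : ℕ), 1 ≤ u₁ → u₁ < u₂ → u₂ ≤ Md →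
      (∀ b ∈ Set.Icc (0:ℝ) 1,
        Jtilde Ma p p01 p11 β κ c Jlim q b u₂ - Jtilde Ma p p01 p11 β κ c Jlim q b u₁ =
          κ * (c u₂ - c u₁) + β * b * ∑ i ∈ Finset.range (Ma + 1),
            p i * (Jlim (Qplus q i u₂) p11 - Jlim (Qplus q i u₁) p11)) ∧
      β * ∑ i ∈ Finset.range (Ma + 1),
        p i * (Jlim (Qplus q i u₂) p11 - Jlim (Qplus q i u₁) p11) ≤ 0 ∧
      Jtilde Ma p p01 p11 β κ c Jlim q 0 u₂ - Jtilde Ma p p01 p11 β κ c Jlim q 0 u₁ =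
        κ * (c u₂ - c u₁) ∧
      0 < κ * (c u₂ - c u₁) ∧
      AntitoneOn (fun b => Jtilde Ma p p01 p11 β κ c Jlim q b u₂ -
        Jtilde Ma p p01 p11 β κ c Jlim q b u₁) (Set.Icc (0:ℝ) 1) := by
  intro q u₁ u₂ h1 h12 h2
  have hform : ∀ b : ℝ,
      Jtilde Ma p p01 p11 β κ c Jlim q b u₂ - Jtilde Ma p p01 p11 β κ c Jlim q b u₁ =
        κ * (c u₂ - c u₁) + β * b * ∑ i ∈ Finset.range (Ma + 1),
          p i * (Jlim (Qplus q i u₂) p11 - Jlim (Qplus q i u₁) p11) := by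
    intro b
    unfold Jtilde
    rw [if_neg (by omega), if_neg (by omega)]
    have : b * ∑ i ∈ Finset.range (Ma + 1),
          p i * (Jlim (Qplus q i u₂) p11 - Jlim (Qplus q i u₁) p11) =
        ∑ i ∈ Finset.range (Ma + 1),
          p i * (b * Jlim (Qplus q i u₂) p11 + (1 - b) * Jlim (Qplus q i 0) p01) -
        ∑ i ∈ Finset.range (Ma + 1),
          p i * (b * Jlim (Qplus q i u₁) p11 + (1 - b) * Jlim (Qplus q i 0) p01) := by
      rw [Finset.mul_sum, ← Finset.sum_sub_distrib]
      exact Finset.sum_congr rfl fun i _ => by ring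
    rw [mul_assoc, this]
    ring
  have hp11' : p11 ∈ Set.Icc (0:ℝ) 1 := ⟨hp11.1.le, hp11.2.le⟩
  have hneg : β * ∑ i ∈ Finset.range (Ma + 1),
        p i * (Jlim (Qplus q i u₂) p11 - Jlim (Qplus q i u₁) p11) ≤ 0 := by
    refine mul_nonpos_of_nonneg_of_nonpos hβ.1.le (Finset.sum_nonpos fun i hi => ?_)
    refine mul_nonpos_of_nonneg_of_nonpos (hp i (by simp at hi; omega)).1 (sub_nonpos.2 ?_)
    refine le_of_tendsto_of_tendsto' (hJlim _ _ hp11') (hJlim _ _ hp11') fun n => ?_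
    exact Jiter_mono_q Ma Md p hp p01 p11 hp01 hp11 β hβ κ c n _ _
      (by unfold Qplus; omega) _ hp11'
  refine ⟨fun b _ => hform b, hneg, ?_, mul_pos hκ (sub_pos.2 (hcmono _ _ h12 h2)), ?_⟩
  · rw [hform]; ring
  · intro a _ b _ hab
    simp only [hform]
    nlinarith [mul_le_mul_of_nonpos_right hab hneg]
end
end

section
/- (Proposition 1) For every q ∈ ℤ≥0 and every action u ∈ {1,…,M_d}, the decision set S_q(u) is a convex subset of [0,1]: if b₁, b₂ ∈ S_q(u) and γ ∈ [0,1], then γ·b₁ + (1−γ)·b₂ ∈ S_q(u). That is, the set of belief states in which transmitting u packets is optimal (for queue length q) is a contiguous interval. -/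
open Finset Filter Topology

noncomputable section

lemma jt_affine (Ma : ℕ) (p : ℕ → ℝ) (p01 p11 β κ : ℝ) (c : ℕ → ℝ)
    (J : ℕ → ℝ → ℝ) (q u : ℕ) (hu : u ≠ 0) (x y g : ℝ) :
    Jtilde Ma p p01 p11 β κ c J q (g * x + (1 - g) * y) u =
      g * Jtilde Ma p p01 p11 β κ c J q x u + (1 - g) * Jtilde Ma p p01 p11 β κ c J q y u := by
  simp only [Jtilde, if_neg hu]
  have : ∑ i ∈ Finset.range (Ma + 1), p i * ((g * x + (1 - g) * y) * J (Qplus q i u) p11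
        + (1 - (g * x + (1 - g) * y)) * J (Qplus q i 0) p01) =
      g * ∑ i ∈ Finset.range (Ma + 1), p i * (x * J (Qplus q i u) p11 + (1 - x) * J (Qplus q i 0) p01)
      + (1 - g) * ∑ i ∈ Finset.range (Ma + 1),
        p i * (y * J (Qplus q i u) p11 + (1 - y) * J (Qplus q i 0) p01) := by
    rw [Finset.mul_sum, Finset.mul_sum, ← Finset.sum_add_distrib]
    exact Finset.sum_congr rfl fun i _ => by ring
  rw [this]; ring

lemma comb_mem {x y g : ℝ} (hx : x ∈ Set.Icc (0:ℝ) 1) (hy : y ∈ Set.Icc (0:ℝ) 1)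
    (hg : g ∈ Set.Icc (0:ℝ) 1) : g * x + (1 - g) * y ∈ Set.Icc (0:ℝ) 1 := by
  have := (convex_Icc (0:ℝ) 1) hx hy hg.1 (sub_nonneg.2 hg.2) (by ring)
  simpa using this

lemma jiter_concave (Ma Md : ℕ)
    (p : ℕ → ℝ) (hp : ∀ i ≤ Ma, p i ∈ Set.Icc (0:ℝ) 1)
    (p01 p11 : ℝ) (hp01 : p01 ∈ Set.Ioo (0:ℝ) 1) (hp11 : p11 ∈ Set.Ioo (0:ℝ) 1)
    (β : ℝ) (hβ : β ∈ Set.Ioo (0:ℝ) 1) (κ : ℝ) (c : ℕ → ℝ) (n : ℕ) :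
    ∀ (q : ℕ) (x y g : ℝ), x ∈ Set.Icc (0:ℝ) 1 → y ∈ Set.Icc (0:ℝ) 1 → g ∈ Set.Icc (0:ℝ) 1 →
      g * Jiter Ma Md p p01 p11 β κ c n q x + (1 - g) * Jiter Ma Md p p01 p11 β κ c n q y
        ≤ Jiter Ma Md p p01 p11 β κ c n q (g * x + (1 - g) * y) := by
  induction n with
  | zero => intro q x y g _ _ _; simp [Jiter]
  | succ n ih =>
    intro q x y g hx hy hg
    have hg' : 0 ≤ 1 - g := sub_nonneg.2 hg.2
    simp only [Jiter]
    apply Finset.le_inf'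
    intro u hu
    refine le_trans (add_le_add
      (mul_le_mul_of_nonneg_left (Finset.inf'_le _ hu) hg.1)
      (mul_le_mul_of_nonneg_left (Finset.inf'_le _ hu) hg')) ?_
    by_cases h0 : u = 0
    · subst h0
      simp only [Jtilde, if_true]
      set J := Jiter Ma Md p p01 p11 β κ c n
      have hT : ∀ b ∈ Set.Icc (0:ℝ) 1, beliefT p01 p11 b ∈ Set.Icc (0:ℝ) 1 := fun b hb =>
        comb_mem (Set.Ioo_subset_Icc_self hp11) (Set.Ioo_subset_Icc_self hp01) hb
      have hTa : beliefT p01 p11 (g * x + (1 - g) * y)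
          = g * beliefT p01 p11 x + (1 - g) * beliefT p01 p11 y := by
        simp only [beliefT]; ring
      have : g * ∑ i ∈ Finset.range (Ma + 1), p i * J (Qplus q i 0) (beliefT p01 p11 x)
          + (1 - g) * ∑ i ∈ Finset.range (Ma + 1), p i * J (Qplus q i 0) (beliefT p01 p11 y)
          ≤ ∑ i ∈ Finset.range (Ma + 1),
            p i * J (Qplus q i 0) (beliefT p01 p11 (g * x + (1 - g) * y)) := by
        rw [Finset.mul_sum, Finset.mul_sum, ← Finset.sum_add_distrib]
        refine Finset.sum_le_sum fun i hi => ?_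
        have hpi := (hp i (Nat.lt_succ_iff.1 (Finset.mem_range.1 hi))).1
        have h := mul_le_mul_of_nonneg_left
          (ih (Qplus q i 0) _ _ g (hT x hx) (hT y hy) hg) hpi
        rw [hTa]
        linarith
      have := mul_le_mul_of_nonneg_left this hβ.1.le
      linarith
    · exact (jt_affine _ _ _ _ _ _ _ _ _ _ h0 _ _ _).ge

theorem stmt10
    (Ma Md : ℕ) (hMa : 1 ≤ Ma) (hMd : 1 ≤ Md)
    (p : ℕ → ℝ) (hp : ∀ i ≤ Ma, p i ∈ Set.Icc (0:ℝ) 1)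
    (hpsum : ∑ i ∈ Finset.range (Ma + 1), p i = 1)
    (p01 p11 : ℝ) (hp01 : p01 ∈ Set.Ioo (0:ℝ) 1) (hp11 : p11 ∈ Set.Ioo (0:ℝ) 1)
    (β : ℝ) (hβ : β ∈ Set.Ioo (0:ℝ) 1)
    (κ : ℝ) (hκ : 0 < κ)
    (c : ℕ → ℝ) (hc0 : c 0 = 0) (hcnn : ∀ u ≤ Md, 0 ≤ c u)
    (hcmono : ∀ u v : ℕ, u < v → v ≤ Md → c u < c v)
    (Jlim : ℕ → ℝ → ℝ)
    (hJlim : ∀ (q : ℕ), ∀ b ∈ Set.Icc (0:ℝ) 1,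
      Tendsto (fun n => Jiter Ma Md p p01 p11 β κ c n q b) atTop (𝓝 (Jlim q b))) :
    ∀ (q u : ℕ), 1 ≤ u → u ≤ Md → ∀ b₁ b₂ γ : ℝ,
      b₁ ∈ Set.Icc (0:ℝ) 1 → b₂ ∈ Set.Icc (0:ℝ) 1 → γ ∈ Set.Icc (0:ℝ) 1 →
      Jtilde Ma p p01 p11 β κ c Jlim q b₁ u = Jlim q b₁ →
      Jtilde Ma p p01 p11 β κ c Jlim q b₂ u = Jlim q b₂ →
      (γ * b₁ + (1 - γ) * b₂ ∈ Set.Icc (0:ℝ) 1 ∧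
        Jtilde Ma p p01 p11 β κ c Jlim q (γ * b₁ + (1 - γ) * b₂) u =
          Jlim q (γ * b₁ + (1 - γ) * b₂)) := by
  intro q u hu1 huM x y g hx hy hg ex ey
  have hm := comb_mem hx hy hg
  have hu0 : u ≠ 0 := by omega
  refine ⟨hm, le_antisymm ?_ ?_⟩
  · rw [jt_affine _ _ _ _ _ _ _ _ _ _ hu0, ex, ey]
    exact le_of_tendsto_of_tendsto'
      (((hJlim q x hx).const_mul g).add ((hJlim q y hy).const_mul (1 - g))) (hJlim q _ hm)
      fun n => jiter_concave Ma Md p hp p01 p11 hp01 hp11 β hβ κ c n q x y g hx hy hg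
  · have h1 := (hJlim q _ hm).comp (tendsto_add_atTop_nat 1)
    refine le_of_tendsto_of_tendsto' h1 (b := atTop) (g := fun n => Jtilde Ma p p01 p11 β κ c
      (Jiter Ma Md p p01 p11 β κ c n) q (g * x + (1 - g) * y) u) ?_ ?_
    · simp only [Jtilde, if_neg hu0]
      refine Tendsto.const_add _ (Tendsto.const_mul _ (tendsto_finsetSum _ fun i _ => ?_))
      exact (((hJlim _ _ (Set.Ioo_subset_Icc_self hp11)).const_mul _).add
        ((hJlim _ _ (Set.Ioo_subset_Icc_self hp01)).const_mul _)).const_mul _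
    · intro n
      exact Finset.inf'_le _ (Finset.mem_range.2 (Nat.lt_succ_of_le huM))
end
end

section
/- (Proposition 2) For every q ∈ ℤ≥0 and all actions u₁, u₂ with 1 ≤ u₁ < u₂ ≤ M_d: if b₁ ∈ S_q(u₁) and b₂ ∈ S_q(u₂), then b₁ ≤ b₂. That is, for a fixed queue length it is optimal to transmit a larger number of packets only at a higher belief that the channel is good. -/
open Finset Filter Topology

noncomputable section

theorem stmt11
    (Ma Md : ℕ) (hMa : 1 ≤ Ma) (hMd : 1 ≤ Md)
    (p : ℕ → ℝ) (hp : ∀ i ≤ Ma, p i ∈ Set.Icc (0:ℝ) 1)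
    (hpsum : ∑ i ∈ Finset.range (Ma + 1), p i = 1)
    (p01 p11 : ℝ) (hp01 : p01 ∈ Set.Ioo (0:ℝ) 1) (hp11 : p11 ∈ Set.Ioo (0:ℝ) 1)
    (β : ℝ) (hβ : β ∈ Set.Ioo (0:ℝ) 1)
    (κ : ℝ) (hκ : 0 < κ)
    (c : ℕ → ℝ) (hc0 : c 0 = 0) (hcnn : ∀ u ≤ Md, 0 ≤ c u)
    (hcmono : ∀ u v : ℕ, u < v → v ≤ Md → c u < c v)
    (Jlim : ℕ → ℝ → ℝ)
    (hJlim : ∀ (q : ℕ), ∀ b ∈ Set.Icc (0:ℝ) 1,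
      Tendsto (fun n => Jiter Ma Md p p01 p11 β κ c n q b) atTop (𝓝 (Jlim q b))) :
    ∀ (q u₁ u₂ : ℕ), 1 ≤ u₁ → u₁ < u₂ → u₂ ≤ Md →
      ∀ b₁ b₂ : ℝ, b₁ ∈ Set.Icc (0:ℝ) 1 → b₂ ∈ Set.Icc (0:ℝ) 1 →
        Jtilde Ma p p01 p11 β κ c Jlim q b₁ u₁ = Jlim q b₁ →
        Jtilde Ma p p01 p11 β κ c Jlim q b₂ u₂ = Jlim q b₂ →
        b₁ ≤ b₂ := by
  intro q u₁ u₂ h1 h12 h2 b₁ b₂ hb₁ hb₂ e₁ e₂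
  have key : ∀ u, 1 ≤ u → u ≤ Md → ∀ b ∈ Set.Icc (0:ℝ) 1,
      Jlim q b ≤ Jtilde Ma p p01 p11 β κ c Jlim q b u := by
    intro u hu huM b hb
    have hu0 : u ≠ 0 := by omega
    have ht := (hJlim q b hb).comp (tendsto_add_atTop_nat 1)
    have ht2 : Tendsto (fun n => Jtilde Ma p p01 p11 β κ c
        (Jiter Ma Md p p01 p11 β κ c n) q b u) atTop
        (𝓝 (Jtilde Ma p p01 p11 β κ c Jlim q b u)) := by
      simp only [Jtilde, if_neg hu0]
      refine tendsto_const_nhds.add (Tendsto.const_mul β (tendsto_finsetSum _ fun i _ => ?_))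
      exact Tendsto.const_mul _
        ((Tendsto.const_mul _ (hJlim _ p11 ⟨hp11.1.le, hp11.2.le⟩)).add
          (Tendsto.const_mul _ (hJlim _ p01 ⟨hp01.1.le, hp01.2.le⟩)))
    refine le_of_tendsto_of_tendsto' ht ht2 fun n => ?_
    exact Finset.inf'_le _ (Finset.mem_range.mpr (by omega))
  have form : ∀ u, 1 ≤ u → ∀ b, Jtilde Ma p p01 p11 β κ c Jlim q b u =
      (q:ℝ) + κ * c u + (b * (β * ∑ i ∈ Finset.range (Ma + 1), p i * Jlim (Qplus q i u) p11)
        + (1 - b) * (β * ∑ i ∈ Finset.range (Ma + 1), p i * Jlim (Qplus q i 0) p01)) := by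
    intro u hu b
    have hu0 : u ≠ 0 := by omega
    simp only [Jtilde, if_neg hu0, Finset.mul_sum, ← Finset.sum_add_distrib]
    congr 1
    exact Finset.sum_congr rfl fun i _ => by ring
  have k1 := key u₂ (by omega) h2 b₁ hb₁
  have k2 := key u₁ h1 (by omega) b₂ hb₂
  rw [← e₁, form _ h1, form _ (by omega)] at k1
  rw [← e₂, form _ h1, form _ (by omega)] at k2
  have hc := mul_lt_mul_of_pos_left (hcmono u₁ u₂ h12 h2) hκ
  generalize β * ∑ i ∈ Finset.range (Ma + 1), p i * Jlim (Qplus q i u₁) p11 = A₁ at k1 k2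
  generalize β * ∑ i ∈ Finset.range (Ma + 1), p i * Jlim (Qplus q i u₂) p11 = A₂ at k1 k2
  have hpos : 0 < b₂ * (A₁ - A₂) := by linarith
  have hA : 0 < A₁ - A₂ := pos_of_mul_pos_right hpos hb₂.1
  have hmul : b₁ * (A₁ - A₂) ≤ b₂ * (A₁ - A₂) := by linarith
  exact le_of_mul_le_mul_right hmul hA
end
end
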